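/- arXiv:1910.08944 — 6 statements merged into one kernel-verified Lean document; each statement's English description precedes it below -/
import Mathlib

section
/- Let e ∈ ℝ^{n_1} × ⋯ × ℝ^{n_l} and let j* be an index with |e_{j*}| = max_{1≤j≤l} |e_j|. Then (∑_{j≠j*} |e_j|²)^{1/2} ≤ √((l−1)/l) · |e|. -/
/-- TOD contraction: if `j*` is an index at which the block norm is maximal, then
`(∑_{j ≠ j*} |e_j|²)^{1/2} ≤ √((l-1)/l) · |e|`. -/
theorem stmt_1 (l : ℕ) (hl : 0 < l) (n : Fin l → ℕ)
    (e : PiLp 2 (fun j : Fin l => EuclideanSpace ℝ (Fin (n j))))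
    (jstar : Fin l) (hmax : ∀ j : Fin l, ‖e j‖ ≤ ‖e jstar‖) :
    Real.sqrt (∑ j ∈ Finset.univ.erase jstar, ‖e j‖ ^ 2) ≤
      Real.sqrt (((l : ℝ) - 1) / (l : ℝ)) * ‖e‖ := by
  have hl' : (0 : ℝ) < l := by exact_mod_cast hl
  have hl1 : (1 : ℝ) ≤ l := by exact_mod_cast hl
  have hS : ∑ j, ‖e j‖ ^ 2 ≤ (l : ℝ) * ‖e jstar‖ ^ 2 := by
    have h := Finset.sum_le_card_nsmul Finset.univ (fun j => ‖e j‖ ^ 2) (‖e jstar‖ ^ 2)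
      (fun j _ => pow_le_pow_left₀ (norm_nonneg _) (hmax j) 2)
    simpa using h
  have hE := Finset.sum_erase_add Finset.univ (fun j => ‖e j‖ ^ 2) (Finset.mem_univ jstar)
  rw [PiLp.norm_eq_of_L2, ← Real.sqrt_mul (div_nonneg (by linarith) hl'.le)]
  apply Real.sqrt_le_sqrt
  rw [div_mul_eq_mul_div, le_div_iff₀ hl']
  simp only at hE
  rw [← hE] at hS ⊢
  nlinarith
end

section
/- Let Δ > 0, Ω ∈ (0,1) and ϖ > 0. Let e ∈ ℝ^{n_1} × ⋯ × ℝ^{n_l}, μ ∈ ℝ^l, and let j* be the smallest index with |e_{j*}| = max_j |e_j|. Suppose e⁺ agrees with e in every block except block j*, where |e⁺_{j*}| ≤ Δ|μ|, and suppose μ⁺ ∈ ℝ^l satisfies |μ⁺| ≤ Ω|μ|. Then ϖ|e⁺| + |μ⁺| ≤ λ·(ϖ|e| + |μ|), where λ := max{√((l−1)/l), ϖΔ + Ω}. Moreover, if ϖ < (1 − Ω)/Δ then λ < 1. -/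
/-- Lyapunov decrease for the TOD protocol with a zoom quantizer (Proposition 3):
`ϖ|e⁺| + |μ⁺| ≤ λ(ϖ|e| + |μ|)` with `λ = max{√((l-1)/l), ϖΔ + Ω}`, and `λ < 1`
whenever `ϖ < (1-Ω)/Δ`. -/
theorem stmt_2 (l : ℕ) (hl : 0 < l) (n : Fin l → ℕ)
    (Δ Ω ϖ : ℝ) (hΔ : 0 < Δ) (hΩ0 : 0 < Ω) (hΩ1 : Ω < 1) (hϖ : 0 < ϖ)
    (e eplus : PiLp 2 (fun j : Fin l => EuclideanSpace ℝ (Fin (n j))))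
    (μ μplus : EuclideanSpace ℝ (Fin l))
    (jstar : Fin l)
    (hmax : ∀ j : Fin l, ‖e j‖ ≤ ‖e jstar‖)
    (hmin : ∀ j : Fin l, ‖e j‖ = ‖e jstar‖ → jstar ≤ j)
    (hagree : ∀ j : Fin l, j ≠ jstar → eplus j = e j)
    (hq : ‖eplus jstar‖ ≤ Δ * ‖μ‖)
    (hμ : ‖μplus‖ ≤ Ω * ‖μ‖)
    (lam : ℝ) (hlam : lam = max (Real.sqrt (((l : ℝ) - 1) / (l : ℝ))) (ϖ * Δ + Ω)) :
    ϖ * ‖eplus‖ + ‖μplus‖ ≤ lam * (ϖ * ‖e‖ + ‖μ‖) ∧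
      (ϖ < (1 - Ω) / Δ → lam < 1) := by
  have hl' : (0 : ℝ) < l := by exact_mod_cast hl
  have hl1 : (1 : ℝ) ≤ l := by exact_mod_cast hl
  set r := Real.sqrt (((l : ℝ) - 1) / (l : ℝ)) with hr
  have hr0 : 0 ≤ r := Real.sqrt_nonneg _
  have hr2 : r ^ 2 = ((l : ℝ) - 1) / l :=
    Real.sq_sqrt (div_nonneg (by linarith) hl'.le)
  have h1 : ‖e‖ ^ 2 = ‖e jstar‖ ^ 2 + ∑ j ∈ Finset.univ.erase jstar, ‖e j‖ ^ 2 := by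
    rw [PiLp.norm_sq_eq_of_L2, Finset.add_sum_erase _ (fun j => ‖e j‖ ^ 2) (Finset.mem_univ _)]
  have h2 : ‖eplus‖ ^ 2 = ‖eplus jstar‖ ^ 2 + ∑ j ∈ Finset.univ.erase jstar, ‖e j‖ ^ 2 := by
    rw [PiLp.norm_sq_eq_of_L2,
      ← Finset.add_sum_erase _ (fun j => ‖eplus j‖ ^ 2) (Finset.mem_univ jstar)]
    congr 1
    refine Finset.sum_congr rfl fun j hj => ?_
    rw [hagree j (Finset.ne_of_mem_erase hj)]
  have h3 : ‖e‖ ^ 2 ≤ l * ‖e jstar‖ ^ 2 := by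
    rw [PiLp.norm_sq_eq_of_L2]
    calc ∑ j, ‖e j‖ ^ 2 ≤ ∑ _j : Fin l, ‖e jstar‖ ^ 2 :=
          Finset.sum_le_sum fun j _ => pow_le_pow_left₀ (norm_nonneg _) (hmax j) 2
      _ = l * ‖e jstar‖ ^ 2 := by simp
  have h4 : ∑ j ∈ Finset.univ.erase jstar, ‖e j‖ ^ 2 ≤ (r * ‖e‖) ^ 2 := by
    rw [mul_pow, hr2, div_mul_eq_mul_div, le_div_iff₀ hl']
    nlinarith
  have hm := norm_nonneg μ
  have he := norm_nonneg e
  have h5 : ‖eplus‖ ≤ r * ‖e‖ + Δ * ‖μ‖ := by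
    have hre : 0 ≤ r * ‖e‖ := by positivity
    have hdm : 0 ≤ Δ * ‖μ‖ := by positivity
    have h6 : ‖eplus jstar‖ ^ 2 ≤ (Δ * ‖μ‖) ^ 2 := pow_le_pow_left₀ (norm_nonneg _) hq 2
    refine (sq_le_sq₀ (norm_nonneg _) (by positivity)).1 ?_
    nlinarith [mul_nonneg hre hdm]
  have hA : r ≤ lam := hlam ▸ le_max_left _ _
  have hB : ϖ * Δ + Ω ≤ lam := hlam ▸ le_max_right _ _
  refine ⟨?_, fun h => ?_⟩
  · have a1 := mul_le_mul_of_nonneg_left h5 hϖ.le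
    have a2 := mul_le_mul_of_nonneg_right hA (mul_nonneg hϖ.le he)
    have a3 := mul_le_mul_of_nonneg_right hB hm
    nlinarith
  · rw [hlam, max_lt_iff]
    rw [lt_div_iff₀ hΔ] at h
    refine ⟨?_, by linarith⟩
    have : r ^ 2 < 1 := by rw [hr2, div_lt_one hl']; linarith
    nlinarith
end

section
/- Let M₁ > 0, and assume: (i) W̄(H₁(c,x,e,μ), H_f(c,x,e,μ), H_μ(c,x,e,μ), c+1) ≤ λ₁·W̄(e₁, e_f, μ, c) for all c, x, e = (e₁,e_f), μ (the protocol (H_e, H_μ) with H_e = (H₁, H_f) is Lyapunov UGES with constant λ₁); (ii) W̄(v₁, v_f, μ, c+1) ≤ λ₂·W̄(v₁, v_f, μ, c) for all arguments; (iii) |W̄(v₁, v_f, μ, c) − W̄(v₁, v_f', μ, c)| ≤ M₁·|v_f − v_f'| for all arguments; (iv) |H_f(c,x,e,μ)| ≤ |e_f| for all arguments. Then for all c ∈ ℕ, x ∈ ℝ^{n_x}, e = (e₁, e_f), μ, m₁, m₂: W(e, μ, H_e(c,x,e,μ) − e, H_μ(c,x,e,μ) − μ, c+1, 1) ≤ λ₁·W(e,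 μ, m₁, m₂, c, 0) + (1 + λ₁)·M₁·|e_f|. -/
/-- The Lyapunov function of Theorem 2, built from the protocol Lyapunov function `W̄`:
`W(e,μ,m₁,m₂,c,0) = max{W̄(e₁,0,μ,c), W̄(e₁+m₁¹,0,μ+m₂,c)}` and
`W(e,μ,m₁,m₂,c,1) = max{(λ₁/λ₂)·W̄(e₁,0,μ,c), W̄(e₁+m₁¹,0,μ+m₂,c)}`.
Here `b : Bool` encodes the logical variable (`false ↔ 0`, `true ↔ 1`). -/
noncomputable def Wfun {E1 EF EL : Type*} [AddCommGroup E1] [AddCommGroup EF]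
    [AddCommGroup EL] (Wbar : E1 → EF → EL → ℕ → ℝ) (lam1 lam2 : ℝ)
    (e1 : E1) (ef : EF) (μ : EL) (m11 : E1) (m1f : EF) (m2 : EL) (c : ℕ) (b : Bool) : ℝ :=
  if b then
    max ((lam1 / lam2) * Wbar e1 0 μ c) (Wbar (e1 + m11) 0 (μ + m2) c)
  else
    max (Wbar e1 0 μ c) (Wbar (e1 + m11) 0 (μ + m2) c)

/-- The transmission-jump inequality of Theorem 2 (condition (22) of Assumption 4 with
`λ = λ₁` and `α₃W(v) = (1+λ₁)M₁v`): if the protocol `(H_e, H_μ)` with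
`H_e = (H₁, H_f)` is Lyapunov UGES for `W̄` with constant `λ₁`, `W̄` grows at most by
`λ₂` in the counter, is `M₁`-Lipschitz in the feedforward slot, and
`|H_f(c,x,e,μ)| ≤ |e_f|`, then
`W(e, μ, H_e(c,x,e,μ)-e, H_μ(c,x,e,μ)-μ, c+1, 1) ≤ λ₁·W(e,μ,m₁,m₂,c,0) + (1+λ₁)M₁|e_f|`. -/
theorem stmt_11 (n1 nf l nx : ℕ) (lam1 lam2 M₁ : ℝ)
    (hlam1 : 0 < lam1) (hlam1' : lam1 < 1) (hlam2 : 1 ≤ lam2) (hM₁ : 0 < M₁)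
    (Wbar : EuclideanSpace ℝ (Fin n1) → EuclideanSpace ℝ (Fin nf) →
      EuclideanSpace ℝ (Fin l) → ℕ → ℝ)
    (hWnn : ∀ v1 vf μ c, 0 ≤ Wbar v1 vf μ c)
    (H1 : ℕ → EuclideanSpace ℝ (Fin nx) → EuclideanSpace ℝ (Fin n1) →
      EuclideanSpace ℝ (Fin nf) → EuclideanSpace ℝ (Fin l) → EuclideanSpace ℝ (Fin n1))
    (Hf : ℕ → EuclideanSpace ℝ (Fin nx) → EuclideanSpace ℝ (Fin n1) →
      EuclideanSpace ℝ (Fin nf) → EuclideanSpace ℝ (Fin l) → EuclideanSpace ℝ (Fin nf))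
    (Hμ : ℕ → EuclideanSpace ℝ (Fin nx) → EuclideanSpace ℝ (Fin n1) →
      EuclideanSpace ℝ (Fin nf) → EuclideanSpace ℝ (Fin l) → EuclideanSpace ℝ (Fin l))
    (huges : ∀ c x e1 ef μ,
      Wbar (H1 c x e1 ef μ) (Hf c x e1 ef μ) (Hμ c x e1 ef μ) (c + 1) ≤
        lam1 * Wbar e1 ef μ c)
    (hcount : ∀ v1 vf μ c, Wbar v1 vf μ (c + 1) ≤ lam2 * Wbar v1 vf μ c)
    (hlip : ∀ v1 vf vf' μ c, |Wbar v1 vf μ c - Wbar v1 vf' μ c| ≤ M₁ * ‖vf - vf'‖)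
    (hHf : ∀ c x e1 ef μ, ‖Hf c x e1 ef μ‖ ≤ ‖ef‖) :
    ∀ (c : ℕ) (x : EuclideanSpace ℝ (Fin nx)) (e1 : EuclideanSpace ℝ (Fin n1))
      (ef : EuclideanSpace ℝ (Fin nf)) (μ : EuclideanSpace ℝ (Fin l))
      (m11 : EuclideanSpace ℝ (Fin n1)) (m1f : EuclideanSpace ℝ (Fin nf))
      (m2 : EuclideanSpace ℝ (Fin l)),
      Wfun Wbar lam1 lam2 e1 ef μ (H1 c x e1 ef μ - e1) (Hf c x e1 ef μ - ef)
          (Hμ c x e1 ef μ - μ) (c + 1) true ≤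
        lam1 * Wfun Wbar lam1 lam2 e1 ef μ m11 m1f m2 c false + (1 + lam1) * M₁ * ‖ef‖ := by
  intro c x e1 ef μ m11 m1f m2
  have hl2 : 0 < lam2 := by linarith
  simp only [Wfun, if_true, Bool.false_eq_true, if_false, add_sub_cancel]
  have hmax := mul_le_mul_of_nonneg_left
    (le_max_left (Wbar e1 0 μ c) (Wbar (e1 + m11) 0 (μ + m2) c)) hlam1.le
  have hn : 0 ≤ M₁ * ‖ef‖ := by positivity
  have hn' : 0 ≤ lam1 * (M₁ * ‖ef‖) := by positivity
  apply max_le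
  · have h1 := mul_le_mul_of_nonneg_left (hcount e1 0 μ c) (div_pos hlam1 hl2).le
    have h2 : lam1 / lam2 * (lam2 * Wbar e1 0 μ c) = lam1 * Wbar e1 0 μ c := by
      field_simp
    linarith
  · have h1 := huges c x e1 ef μ
    have h2 := (abs_le.mp (hlip (H1 c x e1 ef μ) (Hf c x e1 ef μ) 0 (Hμ c x e1 ef μ) (c + 1))).1
    have h3 := (abs_le.mp (hlip e1 ef 0 μ c)).2
    rw [sub_zero] at h2 h3
    have h4 := mul_le_mul_of_nonneg_left (hHf c x e1 ef μ) hM₁.le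
    have h5 := mul_le_mul_of_nonneg_left h3 hlam1.le
    rw [mul_sub] at h5
    linarith
end

section
/- Let α₁ > 0 and M₁ > 0 and assume α₁·|(v₁, v_f, μ)| ≤ W̄(v₁, v_f, μ, c) and |W̄(v₁, v_f, μ, c) − W̄(v₁, v_f', μ, c)| ≤ M₁·|v_f − v_f'| for all arguments. Let M_e, M_f ≥ 0 and set L₀ := M₁M_e/α₁ and L₁ := λ₂M₁M_e/(λ₁α₁). Then for every b ∈ {0,1}, every real m̄ ≥ 0, and all e = (e₁, e_f), μ, m₁, m₂, c: M₁·(m̄ + M_e·|(e₁, e_f, μ)| + M_f·|e_f|) ≤ L_b·W(e, μ, m₁, m₂, c, b) + M₁·m̄ + (M_eM₁/α₁ + M_f)·M₁·|e_f|. -/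
/-- The growth-domination inequality in the proof of Theorem 2, verifying the flow
condition of Assumption 5 with `L₀ = M₁M_e/α₁`, `L₁ = λ₂M₁M_e/(λ₁α₁)`,
`H_b(x) = M₁·m̄(x)` and `σ_bW(v) = (M_eM₁/α₁ + M_f)M₁·v`. -/
theorem stmt_13 (n1 nf l : ℕ) (lam1 lam2 α₁ M₁ Me Mf : ℝ)
    (hlam1 : 0 < lam1) (hlam1' : lam1 < 1) (hlam2 : 1 ≤ lam2)
    (hα₁ : 0 < α₁) (hM₁ : 0 < M₁) (hMe : 0 ≤ Me) (hMf : 0 ≤ Mf)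
    (Wbar : EuclideanSpace ℝ (Fin n1) → EuclideanSpace ℝ (Fin nf) →
      EuclideanSpace ℝ (Fin l) → ℕ → ℝ)
    (hlow : ∀ v1 vf μ c, α₁ * Real.sqrt (‖v1‖ ^ 2 + ‖vf‖ ^ 2 + ‖μ‖ ^ 2) ≤ Wbar v1 vf μ c)
    (hlip : ∀ v1 vf vf' μ c, |Wbar v1 vf μ c - Wbar v1 vf' μ c| ≤ M₁ * ‖vf - vf'‖) :
    ∀ (b : Bool) (mbar : ℝ), 0 ≤ mbar →
      ∀ (e1 : EuclideanSpace ℝ (Fin n1)) (ef : EuclideanSpace ℝ (Fin nf))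
        (μ : EuclideanSpace ℝ (Fin l)) (m11 : EuclideanSpace ℝ (Fin n1))
        (m1f : EuclideanSpace ℝ (Fin nf)) (m2 : EuclideanSpace ℝ (Fin l)) (c : ℕ),
        M₁ * (mbar + Me * Real.sqrt (‖e1‖ ^ 2 + ‖ef‖ ^ 2 + ‖μ‖ ^ 2) + Mf * ‖ef‖) ≤
          (if b then lam2 * M₁ * Me / (lam1 * α₁) else M₁ * Me / α₁) *
              Wfun Wbar lam1 lam2 e1 ef μ m11 m1f m2 c b +
            M₁ * mbar + (Me * M₁ / α₁ + Mf) * M₁ * ‖ef‖ := by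
  intro b mbar _ e1 ef μ m11 m1f m2 c
  have h1 := hlow e1 ef μ c
  have h2 := (abs_le.mp (hlip e1 ef 0 μ c)).2
  rw [sub_zero] at h2
  set S := Real.sqrt (‖e1‖ ^ 2 + ‖ef‖ ^ 2 + ‖μ‖ ^ 2)
  have hl2 : 0 < lam2 := by linarith
  have hL0 : 0 ≤ M₁ * Me / α₁ := by positivity
  have key : M₁ * Me * S ≤ M₁ * Me / α₁ * Wbar e1 0 μ c + Me * M₁ / α₁ * M₁ * ‖ef‖ := by
    have h3 : α₁ * S ≤ Wbar e1 0 μ c + M₁ * ‖ef‖ := by linarith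
    have h4 := mul_le_mul_of_nonneg_left h3 hL0
    have h5 : M₁ * Me / α₁ * (α₁ * S) = M₁ * Me * S := by field_simp
    have h6 : M₁ * Me / α₁ * (Wbar e1 0 μ c + M₁ * ‖ef‖)
        = M₁ * Me / α₁ * Wbar e1 0 μ c + Me * M₁ / α₁ * M₁ * ‖ef‖ := by ring
    linarith
  have hW : M₁ * Me / α₁ * Wbar e1 0 μ c ≤
      (if b then lam2 * M₁ * Me / (lam1 * α₁) else M₁ * Me / α₁) *
        Wfun Wbar lam1 lam2 e1 ef μ m11 m1f m2 c b := by
    cases b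
    · simp only [Wfun, Bool.false_eq_true, if_false]
      exact mul_le_mul_of_nonneg_left (le_max_left _ _) hL0
    · simp only [Wfun, if_true]
      have hL1 : 0 ≤ lam2 * M₁ * Me / (lam1 * α₁) := by positivity
      refine le_trans (le_of_eq ?_) (mul_le_mul_of_nonneg_left (le_max_left _ _) hL1)
      field_simp
  have h7 : M₁ * (mbar + Me * S + Mf * ‖ef‖)
      = M₁ * Me * S + M₁ * mbar + Mf * M₁ * ‖ef‖ := by ring
  have h8 : (Me * M₁ / α₁ + Mf) * M₁ * ‖ef‖
      = Me * M₁ / α₁ * M₁ * ‖ef‖ + Mf * M₁ * ‖ef‖ := by ring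
  rw [h7, h8]
  linarith
end

section
/- Let c > 0, σ ≥ 0, a ≥ 0 and ε > 0, and let (t_i)_{i∈ℕ} be a strictly increasing real sequence with t_{i+1} − t_i ≥ ε for all i. Let U : [t₀, ∞) → ℝ be nonnegative, continuous on each interval [t_i, t_{i+1}), differentiable on each open interval (t_i, t_{i+1}) with U'(t) ≤ −c·U(t) + σ there, and such that for each i the left limit U(t_{i+1}⁻) := lim_{t→t_{i+1}⁻} U(t) exists and U(t_{i+1}) ≤ U(t_{i+1}⁻) + a. Then for every t ≥ t₀: U(t) ≤ e^{−c(t−t₀)}·U(t₀) + (σ/c + a)·(1 + 1/(1 − e^{−cε})). -/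
/-- Comparison (Gronwall-type) estimate for impulsive differential inequalities
(inequality (37) in the proof of Theorem 1): `U` decays exponentially along flows
(`U' ≤ -cU + σ`), increases by at most `a` at each jump time `t_{i+1}`, and
consecutive jumps are separated by at least `ε`; then
`U(t) ≤ e^{-c(t-t₀)}·U(t₀) + (σ/c + a)·(1 + 1/(1 - e^{-cε}))` for all `t ≥ t₀`. -/
theorem stmt_14 (c σ a ε : ℝ) (hc : 0 < c) (hσ : 0 ≤ σ) (ha : 0 ≤ a) (hε : 0 < ε)
    (t : ℕ → ℝ) (htmono : StrictMono t) (hgap : ∀ i : ℕ, ε ≤ t (i + 1) - t i)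
    (U : ℝ → ℝ)
    (hUnn : ∀ s : ℝ, t 0 ≤ s → 0 ≤ U s)
    (hUcont : ∀ i : ℕ, ContinuousOn U (Set.Ico (t i) (t (i + 1))))
    (hUderiv : ∀ i : ℕ, ∀ s ∈ Set.Ioo (t i) (t (i + 1)),
      ∃ d : ℝ, HasDerivAt U d s ∧ d ≤ -c * U s + σ)
    (hUjump : ∀ i : ℕ, ∃ Ulim : ℝ,
      Filter.Tendsto U (nhdsWithin (t (i + 1)) (Set.Iio (t (i + 1)))) (nhds Ulim) ∧
        U (t (i + 1)) ≤ Ulim + a) :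
    ∀ s : ℝ, t 0 ≤ s →
      U s ≤ Real.exp (-c * (s - t 0)) * U (t 0) +
        (σ / c + a) * (1 + 1 / (1 - Real.exp (-c * ε))) := by
  have hflow : ∀ i : ℕ, ∀ s ∈ Set.Ico (t i) (t (i + 1)),
      U s - σ / c ≤ Real.exp (-c * (s - t i)) * (U (t i) - σ / c) := by
    intro i s hs
    have hanti : AntitoneOn (fun x => Real.exp (c * x) * (U x - σ / c))
        (Set.Ico (t i) (t (i + 1))) := by
      have hd : ∀ x ∈ Set.Ioo (t i) (t (i + 1)), ∃ d : ℝ,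
          HasDerivAt (fun x => Real.exp (c * x) * (U x - σ / c)) d x ∧ d ≤ 0 := by
        intro x hx
        obtain ⟨d, hd, hle⟩ := hUderiv i x hx
        have h1 : HasDerivAt (fun x : ℝ => Real.exp (c * x)) (Real.exp (c * x) * (c * 1)) x :=
          ((hasDerivAt_id x).const_mul c).exp
        refine ⟨_, h1.mul (hd.sub_const (σ / c)), ?_⟩
        have h2 : Real.exp (c * x) * (c * 1) * (U x - σ / c) + Real.exp (c * x) * d
            = Real.exp (c * x) * (d - (-c * U x + σ)) := by
          field_simp
          ring
        rw [h2]
        exact mul_nonpos_of_nonneg_of_nonpos (Real.exp_pos _).le (by linarith)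
      apply antitoneOn_of_deriv_nonpos (convex_Ico _ _)
      · exact ContinuousOn.mul (by fun_prop) ((hUcont i).sub continuousOn_const)
      · intro x hx
        rw [interior_Ico] at hx
        obtain ⟨d, hd, _⟩ := hd x hx
        exact hd.differentiableAt.differentiableWithinAt
      · intro x hx
        rw [interior_Ico] at hx
        obtain ⟨d, hd, hle⟩ := hd x hx
        rw [hd.deriv]
        exact hle
    have h := hanti (Set.left_mem_Ico.2 (htmono (Nat.lt_succ_self i))) hs hs.1
    simp only at h
    have h3 := mul_le_mul_of_nonneg_left h (Real.exp_pos (-c * s)).le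
    rw [← mul_assoc, ← mul_assoc, ← Real.exp_add, ← Real.exp_add] at h3
    have e1 : -c * s + c * s = 0 := by ring
    have e2 : -c * s + c * t i = -c * (s - t i) := by ring
    rw [e1, e2, Real.exp_zero, one_mul] at h3
    exact h3
  have hq : Real.exp (-c * ε) < 1 := by
    rw [Real.exp_lt_one_iff]
    nlinarith [mul_pos hc hε]
  obtain ⟨K, hK⟩ : ∃ K, K = 1 / (1 - Real.exp (-c * ε)) := ⟨_, rfl⟩
  have hK0 : 0 < K := by rw [hK]; exact one_div_pos.2 (by linarith)
  have hK1 : K * (1 - Real.exp (-c * ε)) = 1 := by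
    rw [hK]; exact one_div_mul_cancel (by linarith)
  have hjump : ∀ i : ℕ, U (t (i + 1)) - σ / c ≤
      Real.exp (-c * (t (i + 1) - t i)) * (U (t i) - σ / c) + a := by
    intro i
    obtain ⟨L, hL, hle⟩ := hUjump i
    have hlt : t i < t (i + 1) := htmono (Nat.lt_succ_self i)
    have hc2 : Filter.Tendsto (fun s => Real.exp (-c * (s - t i)) * (U (t i) - σ / c))
        (nhdsWithin (t (i + 1)) (Set.Iio (t (i + 1))))
        (nhds (Real.exp (-c * (t (i + 1) - t i)) * (U (t i) - σ / c))) := by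
      have hcont : Continuous (fun s => Real.exp (-c * (s - t i)) * (U (t i) - σ / c)) := by
        fun_prop
      exact (hcont.tendsto _).mono_left nhdsWithin_le_nhds
    have := le_of_tendsto_of_tendsto (hL.sub_const (σ / c)) hc2 (by
      filter_upwards [Ico_mem_nhdsLT hlt] with s hs using hflow i s hs)
    linarith
  have hsc : 0 ≤ σ / c := div_nonneg hσ hc.le
  have hind : ∀ i : ℕ, U (t i) - σ / c ≤ Real.exp (-c * (t i - t 0)) * U (t 0) + a * K := by
    intro i
    induction i with
    | zero =>
      simp only [sub_self, mul_zero, Real.exp_zero, one_mul]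
      nlinarith [mul_nonneg ha hK0.le]
    | succ i ih =>
      have h1 := mul_le_mul_of_nonneg_left ih (Real.exp_pos (-c * (t (i + 1) - t i))).le
      have h2 : Real.exp (-c * (t (i + 1) - t i)) ≤ Real.exp (-c * ε) := by
        apply Real.exp_le_exp.2
        nlinarith [hgap i]
      rw [mul_add, ← mul_assoc, ← Real.exp_add] at h1
      have e : -c * (t (i + 1) - t i) + -c * (t i - t 0) = -c * (t (i + 1) - t 0) := by ring
      rw [e] at h1
      have h3 := mul_le_mul_of_nonneg_right h2 (mul_nonneg ha hK0.le)
      have h4 : Real.exp (-c * ε) * (a * K) + a = a * K := by linear_combination (-a) * hK1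
      linarith [hjump i]
  have hgrow : ∀ n : ℕ, t 0 + n * ε ≤ t n := by
    intro n
    induction n with
    | zero => simp
    | succ n ih =>
      push_cast
      linarith [hgap n]
  intro s hs
  have hloc : ∀ n : ℕ, s < t n → ∃ i, s ∈ Set.Ico (t i) (t (i + 1)) := by
    intro n
    induction n with
    | zero => intro h; linarith
    | succ n ih =>
      intro h
      by_cases h' : s < t n
      · exact ih h'
      · exact ⟨n, not_lt.1 h', h⟩
  obtain ⟨n, hn⟩ := exists_nat_gt ((s - t 0) / ε)
  rw [div_lt_iff₀ hε] at hn
  obtain ⟨i, hi⟩ := hloc n (by linarith [hgrow n])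
  rw [← hK]
  have h0 := hflow i s hi
  have h1 := mul_le_mul_of_nonneg_left (hind i) (Real.exp_pos (-c * (s - t i))).le
  rw [mul_add, ← mul_assoc, ← Real.exp_add] at h1
  have e : -c * (s - t i) + -c * (t i - t 0) = -c * (s - t 0) := by ring
  rw [e] at h1
  have h2 : Real.exp (-c * (s - t i)) ≤ 1 := by
    rw [Real.exp_le_one_iff]
    nlinarith [hi.1]
  have h3 := mul_le_mul_of_nonneg_right h2 (mul_nonneg ha hK0.le)
  nlinarith [mul_nonneg hsc hK0.le]
end

section
/- Let ρ, θ, γ, ϱ > 0 and L ≥ 0, and let V, W, H, φ, s_V, s_W, A, B be real numbers with W ≥ 0, H ≥ 0, φ ≥ 0, s_W ≥ 0, A ≤ −ρV − H² + (γ² − θ)W² + s_V, and B ≤ LW + H + s_W. Then A + γ·(−2Lφ − γ((1+ϱ)φ² + 1))·W² + 2γφW·B ≤ −ρV − θW² + s_V + s_W²/ϱ. -/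
/-- The pointwise algebraic estimate at the heart of the flow computation (32) in the
proof of Theorem 1: combining the bound `A` on the derivative of `V`, the Riccati term
for the clock function `φ`, and the bound `B` on the derivative of `W` yields the
exponential decrease of `U = V + γφW²` up to the disturbance terms `s_V + s_W²/ϱ`. -/
theorem stmt_15 (ρ θ γ ϱ L V W H φ sV sW A B : ℝ)
    (hρ : 0 < ρ) (hθ : 0 < θ) (hγ : 0 < γ) (hϱ : 0 < ϱ) (hL : 0 ≤ L)
    (hW : 0 ≤ W) (hH : 0 ≤ H) (hφ : 0 ≤ φ) (hsW : 0 ≤ sW)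
    (hA : A ≤ -ρ * V - H ^ 2 + (γ ^ 2 - θ) * W ^ 2 + sV)
    (hB : B ≤ L * W + H + sW) :
    A + γ * (-(2 * L * φ) - γ * ((1 + ϱ) * φ ^ 2 + 1)) * W ^ 2 + 2 * γ * φ * W * B ≤
      -ρ * V - θ * W ^ 2 + sV + sW ^ 2 / ϱ := by
  have h1 : 2 * γ * φ * W * B ≤ 2 * γ * φ * W * (L * W + H + sW) :=
    mul_le_mul_of_nonneg_left hB (by positivity)
  have h2 : 0 ≤ (ϱ * (γ * φ * W) - sW) ^ 2 / ϱ := by positivity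
  have h3 : (ϱ * (γ * φ * W) - sW) ^ 2 / ϱ
      = ϱ * (γ * φ * W) ^ 2 - 2 * (γ * φ * W) * sW + sW ^ 2 / ϱ := by
    field_simp
    ring
  rw [h3] at h2
  linarith [sq_nonneg (H - γ * φ * W)]
end
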